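/- (Ko–Lee) Let u, v, w be integers such that the braid L = σ₁ᵘ σ₂ᵛ σ₁ʷ σ₂⁻¹ admits a non-degenerate (negative) flype, i.e. |v| ≥ 2, the integers u, v−1, w are pairwise distinct, and neither u nor w belongs to {0, −1, −2}. Then the conjugacy class of L contains a braid admitting a positive flype — that is, L is conjugate in B₃ to a braid of the form σ₁^{u'} σ₂^{v'} σ₁^{w'} σ₂ for some integers u', v', w' — if and only if u = 1 or w = 1 or v = 2. -/

import Mathlib

/-- The single braid relation `σ₁σ₂σ₁ = σ₂σ₁σ₂` for the classical presentation of `B₃`. -/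
def braidRels : Set (FreeGroup (Fin 2)) :=
  { FreeGroup.of 0 * FreeGroup.of 1 * FreeGroup.of 0 *
      (FreeGroup.of 1 * FreeGroup.of 0 * FreeGroup.of 1)⁻¹ }

/-- The braid group `B₃ = ⟨σ₁, σ₂ | σ₁σ₂σ₁ = σ₂σ₁σ₂⟩`. -/
abbrev B3 := PresentedGroup braidRels

/-- The classical generators `σ₁ = σ 0`, `σ₂ = σ 1` of `B₃`. -/
def σ (i : Fin 2) : B3 := PresentedGroup.of i

/-- The half twist `Δ = σ₁σ₂σ₁`. -/
def halfTwist : B3 := σ 0 * σ 1 * σ 0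

lemma braid_relation : σ 0 * σ 1 * σ 0 = σ 1 * σ 0 * σ 1 := by
  have h : PresentedGroup.mk braidRels _ = 1 :=
    PresentedGroup.one_of_mem (rels := braidRels) (Set.mem_singleton _)
  simp only [map_mul, map_inv, mul_inv_eq_one] at h
  exact h

lemma halfTwist_mul_σ_zero : halfTwist * σ 0 = σ 1 * halfTwist := by
  unfold halfTwist
  rw [braid_relation]
  conv_rhs => rw [← braid_relation]
  simp only [mul_assoc]

lemma halfTwist_mul_σ_one : halfTwist * σ 1 = σ 0 * halfTwist := by
  unfold halfTwist
  conv_rhs => rw [braid_relation]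
  simp only [mul_assoc]

lemma halfTwist_sq_mem_center : halfTwist ^ 2 ∈ Subgroup.center B3 := by
  have key : (⊤ : Subgroup B3) ≤ Subgroup.centralizer {halfTwist ^ 2} := by
    rw [← PresentedGroup.closure_range_of braidRels, Subgroup.closure_le]
    rintro _ ⟨i, rfl⟩
    rw [SetLike.mem_coe, Subgroup.mem_centralizer_singleton_iff]
    change σ i * _ = _ * σ i
    fin_cases i
    · simp only [Fin.zero_eta, pow_two, mul_assoc, halfTwist_mul_σ_zero]
      rw [← mul_assoc halfTwist, halfTwist_mul_σ_one, mul_assoc]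
    · simp only [Fin.mk_one, pow_two, mul_assoc, halfTwist_mul_σ_one]
      rw [← mul_assoc halfTwist, halfTwist_mul_σ_zero, mul_assoc]
  rw [Subgroup.mem_center_iff]
  intro g
  exact (Subgroup.mem_centralizer_singleton_iff.mp (key (Subgroup.mem_top g)))

lemma σ_one_zpow (n : ℤ) : σ 1 ^ n = halfTwist⁻¹ * σ 0 ^ n * halfTwist := by
  have h : σ 1 = halfTwist⁻¹ * σ 0 * (halfTwist⁻¹)⁻¹ := by
    rw [inv_inv, mul_assoc, ← halfTwist_mul_σ_one, inv_mul_cancel_left]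
  rw [h, conj_zpow, inv_inv]

/-- The cyclic word `Δσ₁ˣΔσ₁ʸΔσ₁ᶻ`. -/
def cyclicWord (x y z : ℤ) : B3 :=
  halfTwist * σ 0 ^ x * (halfTwist * σ 0 ^ y) * (halfTwist * σ 0 ^ z)

lemma cyclicWord_rotate (x y z : ℤ) : IsConj (cyclicWord x y z) (cyclicWord y z x) := by
  rw [isConj_iff]
  exact ⟨(halfTwist * σ 0 ^ x)⁻¹, by unfold cyclicWord; group⟩

lemma isConj_positive_flype (u v w : ℤ) :
    IsConj (σ 0 ^ u * σ 1 ^ v * σ 0 ^ w * σ 1)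
      ((halfTwist ^ 2)⁻¹ * cyclicWord v (w - 1) (u - 1)) := by
  rw [isConj_iff]
  refine ⟨(σ 0 ^ u)⁻¹, ?_⟩
  have h : σ 1 = (σ 0)⁻¹ * halfTwist * (σ 0)⁻¹ := by unfold halfTwist; group
  rw [σ_one_zpow, h]
  unfold cyclicWord
  group

lemma isConj_negative_flype (u v w : ℤ) :
    IsConj (σ 0 ^ u * σ 1 ^ v * σ 0 ^ w * (σ 1)⁻¹)
      ((halfTwist ^ 2)⁻¹ * ((halfTwist ^ 2)⁻¹ * cyclicWord v (w + 1) (u + 1))) := by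
  rw [isConj_iff]
  refine ⟨(σ 0 ^ u)⁻¹, ?_⟩
  have h : σ 1 = (σ 0)⁻¹ * halfTwist * (σ 0)⁻¹ := by unfold halfTwist; group
  have hc := Subgroup.mem_center_iff.mp halfTwist_sq_mem_center
  have e : cyclicWord v (w + 1) (u + 1) = halfTwist ^ 2 * (halfTwist *
      σ 0 ^ v * halfTwist * σ 0 ^ (w + 1) * halfTwist⁻¹ * σ 0 ^ (u + 1)) := by
    rw [show halfTwist ^ 2 * (halfTwist *
      σ 0 ^ v * halfTwist * σ 0 ^ (w + 1) * halfTwist⁻¹ * σ 0 ^ (u + 1)) =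
      halfTwist ^ 2 * (halfTwist *
      σ 0 ^ v * halfTwist * σ 0 ^ (w + 1)) * (halfTwist⁻¹ * σ 0 ^ (u + 1)) by
        simp only [mul_assoc], ← hc]
    unfold cyclicWord
    group
  rw [σ_one_zpow, h, e]
  group

lemma isConj_mul_left_of_mem_center {G : Type*} [Group G] {c x y : G}
    (hc : c ∈ Subgroup.center G) : IsConj (c * x) (c * y) ↔ IsConj x y := by
  have hc := Subgroup.mem_center_iff.mp hc
  simp only [isConj_iff]
  refine exists_congr fun g => ?_
  rw [← mul_assoc g, hc g, mul_assoc c, mul_assoc c, mul_right_inj]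

/-- Conjugacy of a negative flype braid and a positive flype braid. -/
lemma isConj_flypes_iff (u v w u' v' w' : ℤ) :
    IsConj (σ 0 ^ u * σ 1 ^ v * σ 0 ^ w * (σ 1)⁻¹)
        (σ 0 ^ u' * σ 1 ^ v' * σ 0 ^ w' * σ 1) ↔
      IsConj (cyclicWord v (w + 1) (u + 1))
        (halfTwist ^ 2 * cyclicWord v' (w' - 1) (u' - 1)) := by
  have hc := inv_mem halfTwist_sq_mem_center
  have hn := isConj_negative_flype u v w
  have hp := isConj_positive_flype u' v' w'
  rw [← isConj_mul_left_of_mem_center hc (x := cyclicWord _ _ _), inv_mul_cancel_left,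
    ← isConj_mul_left_of_mem_center hc (x := _ * cyclicWord _ _ _)]
  exact ⟨fun h => (hn.symm.trans h).trans hp, fun h => (hn.trans h).trans hp.symm⟩

lemma σ_mul_halfTwist_mul_σ : σ 0 * halfTwist * σ 0 = halfTwist * (σ 0)⁻¹ * halfTwist := by
  calc σ 0 * halfTwist * σ 0 = σ 0 * (σ 1 * σ 0 * σ 1) * σ 0 := by
        rw [← braid_relation, halfTwist]
    _ = halfTwist * (σ 0)⁻¹ * halfTwist := by unfold halfTwist; group

lemma isConj_cyclicWord_two (y z : ℤ) :
    IsConj (cyclicWord 2 y z) (halfTwist ^ 2 * cyclicWord (-2) (y - 1) (z - 1)) := by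
  have hc := Subgroup.mem_center_iff.mp halfTwist_sq_mem_center
  have h := σ_mul_halfTwist_mul_σ
  have e : halfTwist ^ 2 * cyclicWord (-2) (y - 1) (z - 1) =
      (halfTwist * (σ 0)⁻¹ * halfTwist) * (halfTwist * (σ 0)⁻¹ * halfTwist) * σ 0 ^ (y - 1) *
        (halfTwist * σ 0 ^ (z - 1)) := by
    have := hc (halfTwist * (σ 0)⁻¹)
    calc _ = (halfTwist ^ 2 * (halfTwist * (σ 0)⁻¹)) * ((σ 0)⁻¹ * halfTwist) * σ 0 ^ (y - 1) *
        (halfTwist * σ 0 ^ (z - 1)) := by unfold cyclicWord; group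
      _ = _ := by rw [← this]; simp only [pow_two, mul_assoc]
  rw [e, ← h, isConj_iff]
  refine ⟨σ 0, ?_⟩
  unfold cyclicWord
  rw [zpow_sub_one, zpow_sub_one, zpow_two, (Commute.zpow_self (σ 0) y).inv_right.eq]
  simp only [mul_assoc, mul_inv_cancel_left]

/-- The binary quadratic form `(1 + xn)α² + (y - x + (xy - 1)n)αβ - (xy - 1)β²` takes no value in
`(0, xy - 1]`. -/
lemma lt_of_quadratic_form_pos (k : ℕ) : ∀ {x y n α β : ℤ}, 2 ≤ x → 2 ≤ y → x ≤ n → y ≤ n →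
    0 < α → α ≤ k →
    0 < (1 + x * n) * α ^ 2 + (y - x + (x * y - 1) * n) * α * β - (x * y - 1) * β ^ 2 →
    x * y - 1 <
      (1 + x * n) * α ^ 2 + (y - x + (x * y - 1) * n) * α * β - (x * y - 1) * β ^ 2 := by
  induction k with
  | zero => intros; omega
  | succ k ih =>
    have main : ∀ {x y n α β : ℤ}, 2 ≤ x → 2 ≤ y → x ≤ n → y ≤ n →
        0 < α → α ≤ k + 1 → β < 0 →
        0 < (1 + x * n) * α ^ 2 + (y - x + (x * y - 1) * n) * α * β - (x * y - 1) * β ^ 2 →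
        x * y - 1 <
          (1 + x * n) * α ^ 2 + (y - x + (x * y - 1) * n) * α * β - (x * y - 1) * β ^ 2 := by
      intro x y n α β hx hy hxn hyn hα hk hβ hQ
      obtain ⟨b, rfl⟩ : ∃ b, β = -b := ⟨-β, by ring⟩
      obtain ⟨e, rfl⟩ : ∃ e, α = b * y - e := ⟨b * y - α, by ring⟩
      have hb : 0 < b := by linarith
      have hxy : 4 ≤ x * y := by nlinarith
      have hxy' : x * y ≤ n * y := by nlinarith
      have hB : 0 < x + y + n + x * y * n := by nlinarith [mul_nonneg (show 0 ≤ x * y by linarith) (show 0 ≤ n by linarith)]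
      have form : (1 + x * n) * (b * y - e) ^ 2 + (y - x + (x * y - 1) * n) * (b * y - e) * (-b)
          - (x * y - 1) * (-b) ^ 2 =
          (1 + y * n) * b ^ 2 - (x + y + n + x * y * n) * b * e + (1 + x * n) * e ^ 2 := by ring
      rcases le_or_gt e 0 with he | he
      · rw [form]
        have h1 : 1 ≤ b ^ 2 := by nlinarith
        have h2 : 0 ≤ (x + y + n + x * y * n) * b * (-e) := by
          apply mul_nonneg (by positivity); linarith
        have h3 : 0 ≤ (1 + x * n) * e ^ 2 := mul_nonneg (by nlinarith) (sq_nonneg e)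
        nlinarith
      · have hlt : 0 < b - x * e := by
          by_contra hcon
          push Not at hcon
          rw [form] at hQ
          have h1 : 0 ≤ n * ((x * e - b) * (b * y - e)) :=
            mul_nonneg (by linarith) (mul_nonneg (by linarith) hα.le)
          have h2 : 0 ≤ (x * e - b) * b := mul_nonneg (by linarith) hb.le
          have h3 : 0 ≤ (b * y - e) * e := mul_nonneg hα.le he.le
          linarith
        have e1 : (1 + x * n) * (b * y - e) ^ 2 + (y - x + (x * y - 1) * n) * (b * y - e) * (-b)
          - (x * y - 1) * (-b) ^ 2 = (1 + x * n) * (b - x * e) ^ 2 +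
            (y - x + (x * y - 1) * n) * (b - x * e) * (n * (b - x * e) - e) -
            (x * y - 1) * (n * (b - x * e) - e) ^ 2 := by ring
        rw [e1] at hQ ⊢
        exact ih hx hy hxn hyn hlt (by nlinarith) hQ
    intro x y n α β hx hy hxn hyn hα hk hQ
    push_cast at hk
    rcases lt_or_ge β 0 with hβ | hβ
    · exact main hx hy hxn hyn hα hk hβ hQ
    · have swap : (1 + x * n) * α ^ 2 + (y - x + (x * y - 1) * n) * α * β - (x * y - 1) * β ^ 2 =
          (1 + y * n) * α ^ 2 + (x - y + (y * x - 1) * n) * α * (n * α - β)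
            - (y * x - 1) * (n * α - β) ^ 2 := by ring
      rcases lt_or_ge (n * α - β) 0 with hγ | hγ
      · rw [swap] at hQ ⊢
        rw [mul_comm x y]
        exact main hy hx hyn hxn hα hk hγ hQ
      · obtain ⟨γ, rfl⟩ : ∃ γ, β = n * α - γ := ⟨n * α - β, by ring⟩
        have hγ' : 0 ≤ γ := by linarith
        have form : (1 + x * n) * α ^ 2 + (y - x + (x * y - 1) * n) * α * (n * α - γ)
            - (x * y - 1) * (n * α - γ) ^ 2 =
            α ^ 2 + α * (x * γ + y * (n * α - γ)) + (x * y - 1) * ((n * α - γ) * γ) := by ring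
        rw [form]
        have hC : 0 < x * y - 1 := by nlinarith
        have hα2 : 1 ≤ α ^ 2 := by nlinarith
        have h1 : 0 ≤ x * γ + y * (n * α - γ) := by positivity
        rcases hγ'.eq_or_lt with rfl | hγ0
        · nlinarith [mul_le_mul_of_nonneg_left hxn (show 0 ≤ y by linarith),
            mul_nonneg (show 0 ≤ y * n by nlinarith) (show 0 ≤ α ^ 2 - 1 by linarith)]
        · rcases hβ.eq_or_lt with hβ0 | hβ0
          · have : γ = n * α := by linarith
            subst this
            nlinarith [mul_le_mul_of_nonneg_left hyn (show 0 ≤ x by linarith),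
              mul_nonneg (show 0 ≤ x * n by nlinarith) (show 0 ≤ α ^ 2 - 1 by linarith)]
          · have h2 : 1 ≤ (n * α - γ) * γ := by nlinarith
            nlinarith [mul_nonneg hα.le h1]

section Representation

variable {G : Type*} [Group G]

/-- The homomorphism out of `B₃` given by two elements satisfying the braid relation. -/
def braidLift (a b : G) (h : a * b * a = b * a * b) : B3 →* G :=
  PresentedGroup.toGroup (f := ![a, b]) (rels := braidRels) (by
    rintro _ rfl
    simp [h])

@[simp] lemma braidLift_σ_zero (a b : G) (h : a * b * a = b * a * b) :
    braidLift a b h (σ 0) = a := by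
  simp [braidLift, σ]

@[simp] lemma braidLift_σ_one (a b : G) (h : a * b * a = b * a * b) :
    braidLift a b h (σ 1) = b := by
  simp [braidLift, σ]

end Representation

/-- Conjugate words have the same exponent sum. -/
lemma exponent_sum_eq {x y z p q r : ℤ}
    (h : IsConj (cyclicWord x y z) (halfTwist ^ 2 * cyclicWord p q r)) :
    x + y + z = p + q + r + 6 := by
  have := (braidLift (Multiplicative.ofAdd (1 : ℤ)) (Multiplicative.ofAdd 1) rfl).map_isConj h
  rw [isConj_iff_eq] at this
  have := congrArg Multiplicative.toAdd this
  simp [cyclicWord, halfTwist] at this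
  linarith

section Burau

variable {K : Type*} [Field K] {t : K}

/-- The diagonal generator of the Burau representation. -/
def burauZero (t : K) (ht : t ≠ 0) : (Matrix (Fin 2) (Fin 2) K)ˣ where
  val := !![t, 0; 0, 1]
  inv := !![t⁻¹, 0; 0, 1]
  val_inv := by simp [Matrix.one_fin_two, ht]
  inv_val := by simp [Matrix.one_fin_two, ht]

/-- The second generator of the Burau representation. -/
def burauOne (t : K) (ht : t ≠ 0) (ht' : 1 - t ≠ 0) : (Matrix (Fin 2) (Fin 2) K)ˣ where
  val := !![1 / (1 - t), 1; -t * (t ^ 2 - t + 1) / (1 - t) ^ 2, -t ^ 2 / (1 - t)]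
  inv := !![-t / (1 - t), -1 / t; (t ^ 2 - t + 1) / (1 - t) ^ 2, 1 / (t * (1 - t))]
  val_inv := by
    ext i j
    fin_cases i <;> fin_cases j <;> simp [Matrix.mul_apply, Fin.sum_univ_two] <;>
      field_simp <;> ring
  inv_val := by
    ext i j
    fin_cases i <;> fin_cases j <;> simp [Matrix.mul_apply, Fin.sum_univ_two] <;>
      field_simp <;> ring

lemma coe_burauZero_zpow (ht : t ≠ 0) (n : ℤ) :
    ((burauZero t ht ^ n : (Matrix (Fin 2) (Fin 2) K)ˣ) : Matrix (Fin 2) (Fin 2) K) =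
      !![t ^ n, 0; 0, 1] := by
  induction n using Int.induction_on with
  | zero => simp [Matrix.one_fin_two]
  | succ n ih => rw [zpow_add_one, Units.val_mul, ih, zpow_add_one₀ ht]; simp [burauZero]
  | pred n ih =>
    rw [zpow_sub_one, Units.val_mul, ih, zpow_sub_one₀ ht, ← Units.inv_eq_val_inv]
    simp [burauZero]

lemma burau_relation (ht : t ≠ 0) (ht' : 1 - t ≠ 0) :
    burauZero t ht * burauOne t ht ht' * burauZero t ht =
      burauOne t ht ht' * burauZero t ht * burauOne t ht ht' := by
  ext i j
  fin_cases i <;> fin_cases j <;> simp [burauZero, burauOne, Matrix.mul_apply, Fin.sum_univ_two] <;>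
      field_simp <;> ring

/-- The reduced Burau representation of `B₃`. -/
def burau (t : K) (ht : t ≠ 0) (ht' : 1 - t ≠ 0) : B3 →* (Matrix (Fin 2) (Fin 2) K)ˣ :=
  braidLift _ _ (burau_relation ht ht')

lemma coe_burau_halfTwist (ht : t ≠ 0) (ht' : 1 - t ≠ 0) :
    (burau t ht ht' halfTwist : Matrix (Fin 2) (Fin 2) K) =
      !![t ^ 2 / (1 - t), t; -t ^ 2 * (t ^ 2 - t + 1) / (1 - t) ^ 2, -t ^ 2 / (1 - t)] := by
  ext i j
  fin_cases i <;> fin_cases j <;>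
    simp [burau, halfTwist, burauZero, burauOne, Matrix.mul_apply, Fin.sum_univ_two] <;>
      field_simp

lemma coe_burau_halfTwist_sq (ht : t ≠ 0) (ht' : 1 - t ≠ 0) :
    (burau t ht ht' (halfTwist ^ 2) : Matrix (Fin 2) (Fin 2) K) = (-t ^ 3) • 1 := by
  rw [map_pow, Units.val_pow_eq_pow_val, coe_burau_halfTwist, pow_two]
  ext i j
  fin_cases i <;> fin_cases j <;>
    simp [Matrix.mul_apply, Fin.sum_univ_two] <;>
      field_simp <;> ring

lemma trace_burau_cyclicWord (ht : t ≠ 0) (ht' : 1 - t ≠ 0) (x y z : ℤ) :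
    (burau t ht ht' (cyclicWord x y z) : Matrix (Fin 2) (Fin 2) K).trace =
      t ^ 5 / (1 - t) ^ 3 * (t * (t ^ x * t ^ y * t ^ z - 1) - (1 - t + t ^ 2) *
        (t ^ x * t ^ y + t ^ y * t ^ z + t ^ x * t ^ z - t ^ x - t ^ y - t ^ z)) := by
  have h : ∀ n : ℤ, (burau t ht ht' (σ 0 ^ n) : Matrix (Fin 2) (Fin 2) K) =
      !![t ^ n, 0; 0, 1] := fun n => by
    rw [map_zpow, ← coe_burauZero_zpow ht]
    simp [burau]
  simp only [cyclicWord, map_mul, Units.val_mul, h, coe_burau_halfTwist]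
  generalize t ^ x = X
  generalize t ^ y = Y
  generalize t ^ z = Z
  simp [Matrix.trace_fin_two]
  field_simp
  ring

lemma trace_eq_of_isConj_units {A B : (Matrix (Fin 2) (Fin 2) K)ˣ} (h : IsConj A B) :
    (A : Matrix (Fin 2) (Fin 2) K).trace = (B : Matrix (Fin 2) (Fin 2) K).trace := by
  obtain ⟨g, rfl⟩ := isConj_iff.mp h
  rw [Units.val_mul, Matrix.trace_mul_comm, ← Units.val_mul, inv_mul_cancel_left]

lemma burau_exponent_identity (ht : t ≠ 0) (ht' : 1 - t ≠ 0) (ht'' : 1 - t + t ^ 2 ≠ 0)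
    {x y z p q r s : ℤ} (hs : s = x + y + z)
    (h : IsConj (cyclicWord x y z) (halfTwist ^ 2 * cyclicWord p q r)) :
    t ^ (s - x) + t ^ (s - y) + t ^ (s - z) + t ^ (s - (p + 3)) + t ^ (s - (q + 3)) +
        t ^ (s - (r + 3)) + t ^ (1 : ℤ) + t ^ (2 : ℤ) =
      t ^ x + t ^ y + t ^ z + t ^ (p + 3) + t ^ (q + 3) + t ^ (r + 3) + t ^ (s - 1) +
        t ^ (s - 2) := by
  have hsum := exponent_sum_eq h
  have htr := trace_eq_of_isConj_units ((burau t ht ht').map_isConj h)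
  rw [map_mul, Units.val_mul, coe_burau_halfTwist_sq, smul_mul_assoc, one_mul, Matrix.trace_smul,
    trace_burau_cyclicWord, trace_burau_cyclicWord, smul_eq_mul] at htr
  rw [mul_left_comm] at htr
  have htr := mul_left_cancel₀ (div_ne_zero (pow_ne_zero 5 ht) (pow_ne_zero 3 ht')) htr
  have e0 : t ^ x * t ^ y * t ^ z = t ^ 2 * t ^ (s - 2) := by
    rw [← zpow_natCast, ← zpow_add₀ ht, ← zpow_add₀ ht, ← zpow_add₀ ht]; congr 1; push_cast; linarith
  have e0' : t ^ 3 * (t ^ p * t ^ q * t ^ r) = t ^ (s - 2) * t⁻¹ := by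
    rw [← zpow_neg_one, ← zpow_natCast, ← zpow_add₀ ht, ← zpow_add₀ ht, ← zpow_add₀ ht,
      ← zpow_add₀ ht]; congr 1; push_cast; linarith
  have e1 : t ^ (s - x) = t ^ y * t ^ z := by rw [← zpow_add₀ ht]; congr 1; linarith
  have e2 : t ^ (s - y) = t ^ x * t ^ z := by rw [← zpow_add₀ ht]; congr 1; linarith
  have e3 : t ^ (s - z) = t ^ x * t ^ y := by rw [← zpow_add₀ ht]; congr 1; linarith
  have e4 : t ^ (s - (p + 3)) = t ^ 3 * (t ^ q * t ^ r) := by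
    rw [← zpow_natCast, ← zpow_add₀ ht, ← zpow_add₀ ht]; congr 1; push_cast; linarith
  have e5 : t ^ (s - (q + 3)) = t ^ 3 * (t ^ p * t ^ r) := by
    rw [← zpow_natCast, ← zpow_add₀ ht, ← zpow_add₀ ht]; congr 1; push_cast; linarith
  have e6 : t ^ (s - (r + 3)) = t ^ 3 * (t ^ p * t ^ q) := by
    rw [← zpow_natCast, ← zpow_add₀ ht, ← zpow_add₀ ht]; congr 1; push_cast; linarith
  have e7 : ∀ n : ℤ, t ^ (n + 3) = t ^ 3 * t ^ n := fun n => by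
    rw [← zpow_natCast, ← zpow_add₀ ht]; congr 1; push_cast; linarith
  have e8 : t ^ (s - 1) = t * t ^ (s - 2) := by
    rw [← zpow_one_add₀ ht]; congr 1; linarith
  rw [e1, e2, e3, e4, e5, e6, e7, e7, e7, e8, zpow_one, show t ^ (2 : ℤ) = t ^ 2 by norm_cast]
  rw [e0] at htr
  have htr' : t * (t ^ 3 * (t ^ p * t ^ q * t ^ r)) = t ^ (s - 2) := by
    rw [e0']; field_simp
  apply mul_left_cancel₀ ht''
  linear_combination (-1 : K) * htr + htr'

end Burau

lemma mem_of_sum_single_eq {a b : Fin 8 → ℤ}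
    (h : ∑ i, (HahnSeries.single (a i) (1 : ℚ)) = ∑ i, HahnSeries.single (b i) (1 : ℚ)) (i : Fin 8) :
    ∃ j, a i = b j := by
  by_contra! hcon
  have h1 := congrArg (fun f : HahnSeries ℤ ℚ => f.coeff (a i)) h
  simp only [HahnSeries.coeff_sum] at h1
  have h2 : ∑ j, (HahnSeries.single (b j) (1 : ℚ)).coeff (a i) = 0 :=
    Finset.sum_eq_zero fun j _ => HahnSeries.coeff_single_of_ne (hcon j)
  rw [h2, Finset.sum_eq_zero_iff_of_nonneg] at h1
  · simpa using h1 i (Finset.mem_univ i)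
  · intro j _
    rw [HahnSeries.coeff_single]
    split_ifs <;> norm_num

lemma exponents_subset {x y z p q r s : ℤ} (hs : s = x + y + z)
    (h : IsConj (cyclicWord x y z) (halfTwist ^ 2 * cyclicWord p q r)) :
    ({s - x, s - y, s - z, 1, 2} : Set ℤ) ⊆
      {x, y, z, p + 3, q + 3, r + 3, s - 1, s - 2} := by
  have hz : ∀ n : ℤ, (HahnSeries.single 1 1 : LaurentSeries ℚ) ^ n = HahnSeries.single n 1 :=
    fun n => (RatFunc.single_zpow n).symm
  have ht : (HahnSeries.single 1 1 : LaurentSeries ℚ) ≠ 0 := by simp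
  have ht' : 1 - (HahnSeries.single 1 1 : LaurentSeries ℚ) ≠ 0 := fun h => by
    simpa using congrArg (fun f : LaurentSeries ℚ => f.coeff 0) h
  have ht'' : 1 - (HahnSeries.single 1 1 : LaurentSeries ℚ) + HahnSeries.single 1 1 ^ 2 ≠ 0 :=
    fun h => by simpa using congrArg (fun f : LaurentSeries ℚ => f.coeff 0) h
  have key := burau_exponent_identity ht ht' ht'' hs h
  simp only [hz] at key
  have := mem_of_sum_single_eq
    (a := ![s - x, s - y, s - z, s - (p + 3), s - (q + 3), s - (r + 3), 1, 2])
    (b := ![x, y, z, p + 3, q + 3, r + 3, s - 1, s - 2])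
    (by simpa [Fin.sum_univ_eight] using key)
  have h0 := this 0
  have h1 := this 1
  have h2 := this 2
  have h6 := this 6
  have h7 := this 7
  simp [Fin.exists_fin_succ, Set.insert_subset_iff] at h0 h1 h2 h6 h7 ⊢
  exact ⟨h0, h1, h2, h6, h7⟩

lemma not_self_reflected {x y z p q r s : ℤ} (hs : s = x + y + z) (hs' : p + q + r = s + 3)
    (hx1 : x ≠ 1) (hx2 : x ≠ 2) (hxy : x ≠ y) (hxz : x ≠ z) (hyz : y ≠ z)
    (h1 : 1 = p ∨ 1 = q ∨ 1 = r ∨ s = 2 ∨ s = 3)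
    (h2 : 2 = p ∨ 2 = q ∨ 2 = r ∨ s = 3 ∨ s = 4)
    (hy : s = 2 * y ∨ s - y = p ∨ s - y = q ∨ s - y = r)
    (hz : s = 2 * z ∨ s - z = p ∨ s - z = q ∨ s - z = r) :
    s ≠ 2 * x := by
  intro h
  replace hy := hy.resolve_left fun h' => hxy (by linarith)
  replace hz := hz.resolve_left fun h' => hxz (by linarith)
  replace h1 : 1 = p ∨ 1 = q ∨ 1 = r := by clear h2 hy hz; omega
  replace h2 : 2 = p ∨ 2 = q ∨ 2 = r := by clear h1 hy hz; omega
  obtain rfl : s = x + y + z := hs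
  obtain rfl : z = x - y := by linarith
  clear hxy hxz
  rcases hy with rfl | rfl | rfl <;> rcases hz with hz | hz | hz <;>
    rcases h1 with h1 | h1 | h1 <;> rcases h2 with h2 | h2 | h2 <;> omega

/-- If the exponents in the equation between Burau traces of a negative and a positive flype braid
match up, then those of the latter are opposite to those of the former, up to a shift. -/
lemma reflected_exponents {x y z p q r s : ℤ} (hs : s = x + y + z) (hs' : p + q + r = s + 3)
    (hxy : x ≠ y) (hyz : y ≠ z) (hxz : x ≠ z)
    (hx : x ∉ ({0, 1, 2} : Set ℤ)) (hy : y ∉ ({0, 1, 2} : Set ℤ)) (hz : z ∉ ({0, 1, 2} : Set ℤ))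
    (h : ({s - x, s - y, s - z, 1, 2} : Set ℤ) ⊆ {x, y, z, p, q, r, s - 1, s - 2}) :
    s = 3 ∧ ({3 - x, 3 - y, 3 - z} : Set ℤ) ⊆ {p, q, r} := by
  simp only [Set.insert_subset_iff, Set.singleton_subset_iff, Set.mem_insert_iff,
    Set.mem_singleton_iff, not_or] at *
  obtain ⟨hx0, hx1, hx2⟩ := hx
  obtain ⟨hy0, hy1, hy2⟩ := hy
  obtain ⟨hz0, hz1, hz2⟩ := hz
  obtain ⟨h1, h2, h3, h4, h5⟩ := h
  have key : ∀ {x y z : ℤ}, s = x + y + z → x ≠ 1 → x ≠ 2 → y ≠ 0 → z ≠ 0 →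
      (s - x = x ∨ s - x = y ∨ s - x = z ∨ s - x = p ∨ s - x = q ∨ s - x = r ∨
        s - x = s - 1 ∨ s - x = s - 2) →
      s = 2 * x ∨ s - x = p ∨ s - x = q ∨ s - x = r := by
    clear * -
    intros
    omega
  have k1 := key hs hx1 hx2 hy0 hz0 h1
  have k2 := key (by rw [hs]; ring) hy1 hy2 hx0 hz0 (or_left_comm.mp h2)
  have k3 := key (by rw [hs]; ring) hz1 hz2 hx0 hy0
    (or_left_comm.mp (h3.imp_right or_left_comm.mp))
  clear key h1 h2 h3
  replace h4 : 1 = p ∨ 1 = q ∨ 1 = r ∨ s = 2 ∨ s = 3 := by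
    rcases h4 with h | h | h | h | h | h | h | h
    exacts [absurd h.symm hx1, absurd h.symm hy1, absurd h.symm hz1, .inl h, .inr (.inl h),
      .inr (.inr (.inl h)), .inr (.inr (.inr (.inl (by linarith)))),
      .inr (.inr (.inr (.inr (by linarith))))]
  replace h5 : 2 = p ∨ 2 = q ∨ 2 = r ∨ s = 3 ∨ s = 4 := by
    rcases h5 with h | h | h | h | h | h | h | h
    exacts [absurd h.symm hx2, absurd h.symm hy2, absurd h.symm hz2, .inl h, .inr (.inl h),
      .inr (.inr (.inl h)), .inr (.inr (.inr (.inl (by linarith)))),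
      .inr (.inr (.inr (.inr (by linarith))))]
  have k1' := k1.resolve_left
    (not_self_reflected hs hs' hx1 hx2 hxy hxz hyz h4 h5 k2 k3)
  have k2' := k2.resolve_left
    (not_self_reflected (by rw [hs]; ring) hs' hy1 hy2 hxy.symm hyz hxz h4 h5 k1 k3)
  have k3' := k3.resolve_left
    (not_self_reflected (by rw [hs]; ring) hs' hz1 hz2 hxz.symm hyz.symm hxy h4 h5 k1 k2)
  clear h4 h5 k1 k2 k3 hx0 hx1 hx2 hy0 hy1 hy2 hz0 hz1 hz2
  obtain rfl : s = 3 := by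
    rcases k1' with rfl | rfl | rfl <;> rcases k2' with h | h | h <;>
      rcases k3' with h' | h' | h' <;> omega
  exact ⟨rfl, k1', k2', k3'⟩

/-- The representation of `B₃` in `SL(2, ℤ)`. -/
def modularRep : B3 →* Matrix.SpecialLinearGroup (Fin 2) ℤ :=
  braidLift ModularGroup.T ⟨!![1, 0; -1, 1], by simp⟩ (by
    apply Subtype.ext
    simp only [Matrix.SpecialLinearGroup.coe_mul, ModularGroup.coe_T]
    decide)

lemma modularRep_σ_zero : modularRep (σ 0) = ModularGroup.T :=
  braidLift_σ_zero _ _ _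

lemma coe_modularRep_σ_one :
    (modularRep (σ 1) : Matrix (Fin 2) (Fin 2) ℤ) = !![1, 0; -1, 1] :=
  congrArg (fun A : Matrix.SpecialLinearGroup (Fin 2) ℤ => (A : Matrix (Fin 2) (Fin 2) ℤ))
    (braidLift_σ_one _ _ _)

lemma coe_modularRep_halfTwist :
    (modularRep halfTwist : Matrix (Fin 2) (Fin 2) ℤ) = !![0, 1; -1, 0] := by
  simp only [halfTwist, map_mul, Matrix.SpecialLinearGroup.coe_mul, modularRep_σ_zero,
    coe_modularRep_σ_one, ModularGroup.coe_T]
  decide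

lemma coe_modularRep_cyclicWord (x y z : ℤ) :
    (modularRep (cyclicWord x y z) : Matrix (Fin 2) (Fin 2) ℤ) =
      !![y, y * z - 1; 1 - x * y, x - z * (x * y - 1)] := by
  have h : ∀ n : ℤ, (modularRep (σ 0 ^ n) : Matrix (Fin 2) (Fin 2) ℤ) = !![1, n; 0, 1] :=
    fun n => by rw [map_zpow, modularRep_σ_zero, ModularGroup.coe_T_zpow]
  simp only [cyclicWord, map_mul, Matrix.SpecialLinearGroup.coe_mul, h, coe_modularRep_halfTwist]
  ext i j
  fin_cases i <;> fin_cases j <;> simp [Matrix.mul_apply, Fin.sum_univ_two] <;> ring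

/-- The quadratic form `v ↦ det (v, Av)` of a `2 × 2` matrix `A`. -/
def fixedForm (A : Matrix (Fin 2) (Fin 2) ℤ) (X Y : ℤ) : ℤ :=
  A 1 0 * X ^ 2 + (A 1 1 - A 0 0) * X * Y - A 0 1 * Y ^ 2

/-- The fixed forms of conjugate elements of `SL(2, ℤ)` represent the same integers. -/
lemma exists_fixedForm_eq_of_isConj {A B : Matrix.SpecialLinearGroup (Fin 2) ℤ} (h : IsConj A B)
    (X Y : ℤ) : ∃ X' Y', fixedForm A X' Y' = fixedForm B X Y := by
  obtain ⟨g, hg⟩ := isConj_iff.mp h.symm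
  have hdet := g.det_coe
  rw [Matrix.det_fin_two] at hdet
  have hA : g * B = A * g := by rw [← hg, inv_mul_cancel_right]
  have hA := congrArg (fun M : Matrix.SpecialLinearGroup (Fin 2) ℤ =>
    (M : Matrix (Fin 2) (Fin 2) ℤ)) hA
  have h00 := congrFun (congrFun hA 0) 0
  have h01 := congrFun (congrFun hA 0) 1
  have h10 := congrFun (congrFun hA 1) 0
  have h11 := congrFun (congrFun hA 1) 1
  simp only [Matrix.SpecialLinearGroup.coe_mul, Matrix.mul_apply, Fin.sum_univ_two] at h00 h01 h10 h11
  refine ⟨g 0 0 * X + g 0 1 * Y, g 1 0 * X + g 1 1 * Y, ?_⟩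
  unfold fixedForm
  generalize (A : Matrix (Fin 2) (Fin 2) ℤ) 0 0 = a at *
  generalize (A : Matrix (Fin 2) (Fin 2) ℤ) 0 1 = b at *
  generalize (A : Matrix (Fin 2) (Fin 2) ℤ) 1 0 = c at *
  generalize (A : Matrix (Fin 2) (Fin 2) ℤ) 1 1 = d at *
  generalize (B : Matrix (Fin 2) (Fin 2) ℤ) 0 0 = a' at *
  generalize (B : Matrix (Fin 2) (Fin 2) ℤ) 0 1 = b' at *
  generalize (B : Matrix (Fin 2) (Fin 2) ℤ) 1 0 = c' at *
  generalize (B : Matrix (Fin 2) (Fin 2) ℤ) 1 1 = d' at *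
  generalize (g : Matrix (Fin 2) (Fin 2) ℤ) 0 0 = p at *
  generalize (g : Matrix (Fin 2) (Fin 2) ℤ) 0 1 = q at *
  generalize (g : Matrix (Fin 2) (Fin 2) ℤ) 1 0 = r at *
  generalize (g : Matrix (Fin 2) (Fin 2) ℤ) 1 1 = s at *
  linear_combination (c' * X ^ 2 + (d' - a') * X * Y - b' * Y ^ 2) * hdet
    - (p * X + q * Y) * (X * h10 + Y * h11) + (r * X + s * Y) * (X * h00 + Y * h01)

lemma quadratic_form_ne {x y n α β : ℤ} (hx : 2 ≤ x) (hy : 2 ≤ y) (hxn : x ≤ n) (hyn : y ≤ n) :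
    (1 + x * n) * α ^ 2 + (y - x + (x * y - 1) * n) * α * β - (x * y - 1) * β ^ 2 ≠
      x * y - 1 := by
  intro h
  have hC : 0 < x * y - 1 := by nlinarith
  rcases lt_trichotomy α 0 with hα | rfl | hα
  · have e : (1 + x * n) * (-α) ^ 2 + (y - x + (x * y - 1) * n) * (-α) * (-β)
        - (x * y - 1) * (-β) ^ 2 = x * y - 1 := by linear_combination h
    have := lt_of_quadratic_form_pos (-α).toNat hx hy hxn hyn (by linarith : 0 < -α)
      (Int.self_le_toNat _) (by rw [e]; exact hC)
    rw [e] at this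
    exact this.false
  · nlinarith [mul_nonneg hC.le (sq_nonneg β)]
  · have := lt_of_quadratic_form_pos α.toNat hx hy hxn hyn hα
      (Int.self_le_toNat _) (by rw [h]; exact hC)
    rw [h] at this
    exact this.false

lemma fixedForm_cyclicWord_ne {x y z : ℤ} (hsum : x + y + z = 3)
    (h : (3 ≤ x ∧ 3 ≤ y ∧ z < 0) ∨ (x ≤ -2 ∧ y ≤ -2 ∧ 0 < z)) (X Y : ℤ) :
    fixedForm (modularRep (cyclicWord x y z)) X Y ≠ x * y - 1 := by
  rw [coe_modularRep_cyclicWord]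
  intro hQ
  simp only [fixedForm, Matrix.of_apply, Matrix.cons_val_zero, Matrix.cons_val_one,
    Matrix.cons_val', Matrix.cons_val_fin_one] at hQ
  rcases h with ⟨hx, hy, hz⟩ | ⟨hx, hy, hz⟩
  · refine quadratic_form_ne (x := y) (y := x) (n := -z) (α := Y) (β := X)
      (by linarith) (by linarith) (by linarith) (by linarith) ?_
    linear_combination hQ
  · refine quadratic_form_ne (x := -y) (y := -x) (n := z) (α := Y) (β := -X)
      (by linarith) (by linarith) (by linarith) (by linarith) ?_
    linear_combination hQ

lemma exists_fixedForm_cyclicWord_eq {p q r x y : ℤ} (hxy : x ≠ y)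
    (hx : -x ∈ ({p, q, r} : Set ℤ)) (hy : -y ∈ ({p, q, r} : Set ℤ)) :
    ∃ X Y, fixedForm (modularRep (halfTwist ^ 2 * cyclicWord p q r)) X Y = x * y - 1 := by
  have e : ((modularRep (halfTwist ^ 2 * cyclicWord p q r) :
      Matrix.SpecialLinearGroup (Fin 2) ℤ) : Matrix (Fin 2) (Fin 2) ℤ) =
      !![-q, 1 - q * r; p * q - 1, -p + r * (p * q - 1)] := by
    rw [map_mul, Matrix.SpecialLinearGroup.coe_mul, coe_modularRep_cyclicWord, map_pow,
      Matrix.SpecialLinearGroup.coe_pow, coe_modularRep_halfTwist, pow_two]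
    ext i j
    fin_cases i <;> fin_cases j <;> simp [Matrix.mul_apply, Fin.sum_univ_two] <;> ring
  rw [e]
  simp only [fixedForm, Matrix.of_apply, Matrix.cons_val_zero, Matrix.cons_val_one,
    Matrix.cons_val', Matrix.cons_val_fin_one]
  simp only [Set.mem_insert_iff, Set.mem_singleton_iff] at hx hy
  obtain ⟨x, rfl⟩ : ∃ x', x = -x' := ⟨-x, by ring⟩
  obtain ⟨y, rfl⟩ : ∃ y', y = -y' := ⟨-y, by ring⟩
  simp only [neg_neg] at hx hy
  rcases hx with rfl | rfl | rfl <;> rcases hy with rfl | rfl | rfl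
  · exact absurd rfl hxy
  · exact ⟨1, 0, by ring⟩
  · exact ⟨-y, 1, by ring⟩
  · exact ⟨1, 0, by ring⟩
  · exact absurd rfl hxy
  · exact ⟨0, 1, by ring⟩
  · exact ⟨-x, 1, by ring⟩
  · exact ⟨0, 1, by ring⟩
  · exact absurd rfl hxy

lemma not_isConj_of_opposite {x y z p q r : ℤ} (hsum : x + y + z = 3) (hxy : x ≠ y)
    (h : (3 ≤ x ∧ 3 ≤ y ∧ z < 0) ∨ (x ≤ -2 ∧ y ≤ -2 ∧ 0 < z))
    (hx : -x ∈ ({p, q, r} : Set ℤ)) (hy : -y ∈ ({p, q, r} : Set ℤ)) :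
    ¬ IsConj (cyclicWord x y z) (halfTwist ^ 2 * cyclicWord p q r) := by
  intro hc
  obtain ⟨X, Y, hXY⟩ := exists_fixedForm_cyclicWord_eq hxy hx hy
  obtain ⟨X', Y', h'⟩ := exists_fixedForm_eq_of_isConj (modularRep.map_isConj hc) X Y
  exact fixedForm_cyclicWord_ne hsum h X' Y' (h'.trans hXY)

lemma not_isConj_cyclicWord {x y z p q r : ℤ} (hxy : x ≠ y) (hyz : y ≠ z) (hxz : x ≠ z)
    (hx : 2 ≤ |x|) (hy : 2 ≤ |y|) (hz : 2 ≤ |z|) (hx2 : x ≠ 2) (hy2 : y ≠ 2) (hz2 : z ≠ 2) :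
    ¬ IsConj (cyclicWord x y z) (halfTwist ^ 2 * cyclicWord p q r) := by
  intro h
  have range : ∀ {n : ℤ}, 2 ≤ |n| → n ≠ 2 → n ≤ -2 ∨ 3 ≤ n := by
    intro n hn hn2
    rcases le_abs.mp hn with hn | hn <;> omega
  have notMem : ∀ {n : ℤ}, n ≤ -2 ∨ 3 ≤ n → n ∉ ({0, 1, 2} : Set ℤ) := by
    intro n hn
    simp only [Set.mem_insert_iff, Set.mem_singleton_iff]
    omega
  replace hx := range hx hx2
  replace hy := range hy hy2
  replace hz := range hz hz2
  have hsum := exponent_sum_eq h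
  obtain ⟨hs, hmem⟩ := reflected_exponents rfl (by rw [hsum]; ring) hxy hyz hxz (notMem hx)
    (notMem hy) (notMem hz) (exponents_subset rfl h)
  have shift : ∀ n : ℤ, 3 - n ∈ ({p + 3, q + 3, r + 3} : Set ℤ) → -n ∈ ({p, q, r} : Set ℤ) := by
    intro n hn
    simp only [Set.mem_insert_iff, Set.mem_singleton_iff] at hn ⊢
    omega
  have mx := shift x (hmem (by simp))
  have my := shift y (hmem (by simp))
  have mz := shift z (hmem (by simp))
  have rot := cyclicWord_rotate x y z
  have rot' := rot.trans (cyclicWord_rotate y z x)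
  have cases : ((3 ≤ x ∧ 3 ≤ y ∧ z < 0) ∨ (x ≤ -2 ∧ y ≤ -2 ∧ 0 < z)) ∨
      ((3 ≤ y ∧ 3 ≤ z ∧ x < 0) ∨ (y ≤ -2 ∧ z ≤ -2 ∧ 0 < x)) ∨
      ((3 ≤ z ∧ 3 ≤ x ∧ y < 0) ∨ (z ≤ -2 ∧ x ≤ -2 ∧ 0 < y)) := by
    clear mx my mz hmem hsum
    rcases hx with hx | hx <;> rcases hy with hy | hy <;> rcases hz with hz | hz <;> omega
  rcases cases with hc | hc | hc
  · exact not_isConj_of_opposite hs hxy hc mx my h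
  · exact not_isConj_of_opposite (by rw [← hs]; ring) hyz hc my mz (rot.symm.trans h)
  · exact not_isConj_of_opposite (by rw [← hs]; ring) hxz.symm hc mz mx (rot'.symm.trans h)

/-- (Ko–Lee) Suppose `L = σ₁ᵘσ₂ᵛσ₁ʷσ₂⁻¹` admits a non-degenerate (negative) flype,
i.e. `|v| ≥ 2`, the integers `u, v−1, w` are pairwise distinct, and neither `u` nor
`w` lies in `{0, −1, −2}`.  Then the conjugacy class of `L` contains a braid
admitting a positive flype — `L` is conjugate to some `σ₁^{u'}σ₂^{v'}σ₁^{w'}σ₂` —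
if and only if `u = 1` or `w = 1` or `v = 2`. -/
theorem ko_lee_negative_flype_admits_positive (u v w : ℤ)
    (hv : 2 ≤ |v|)
    (h₁ : u ≠ v - 1) (h₂ : u ≠ w) (h₃ : v - 1 ≠ w)
    (hu : u ≠ 0 ∧ u ≠ -1 ∧ u ≠ -2)
    (hw : w ≠ 0 ∧ w ≠ -1 ∧ w ≠ -2) :
    (∃ u' v' w' : ℤ,
        IsConj (σ 0 ^ u * σ 1 ^ v * σ 0 ^ w * (σ 1)⁻¹)
          (σ 0 ^ u' * σ 1 ^ v' * σ 0 ^ w' * σ 1)) ↔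
      (u = 1 ∨ w = 1 ∨ v = 2) := by
  simp only [isConj_flypes_iff]
  constructor
  · rintro ⟨u', v', w', h⟩
    by_contra! hne
    have habs : ∀ {n : ℤ}, n ≠ 0 → n ≠ -1 → n ≠ -2 → 2 ≤ |n + 1| := by
      intro n h0 h1 h2
      rw [le_abs]
      omega
    exact not_isConj_cyclicWord (by omega) (by omega) (by omega) hv (habs hw.1 hw.2.1 hw.2.2)
      (habs hu.1 hu.2.1 hu.2.2) hne.2.2 (by omega) (by omega) h
  · have key : ∀ y z : ℤ, ∃ u' v' w' : ℤ,
        IsConj (cyclicWord 2 y z) (halfTwist ^ 2 * cyclicWord v' (w' - 1) (u' - 1)) :=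
      fun y z => ⟨z, -2, y, isConj_cyclicWord_two y z⟩
    have rotate : ∀ {x y z : ℤ}, (∃ u' v' w' : ℤ,
        IsConj (cyclicWord y z x) (halfTwist ^ 2 * cyclicWord v' (w' - 1) (u' - 1))) →
        ∃ u' v' w' : ℤ,
        IsConj (cyclicWord x y z) (halfTwist ^ 2 * cyclicWord v' (w' - 1) (u' - 1)) :=
      fun ⟨u', v', w', h⟩ => ⟨u', v', w', (cyclicWord_rotate _ _ _).trans h⟩
    rintro (rfl | rfl | rfl)
    · exact rotate (rotate (key _ _))
    · exact rotate (key _ _)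
    · exact key _ _
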